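/- (Lemma 1, quantum form.) Let n ∈ ℕ and let V ⊆ {0,…,n−1} with |V| = m. Suppose there exist i, j, k with i ∈ V, i+1 ∈ V, j ∈ V, k ∈ V, j < i and k > i+1 (a 2-island with both a left and a right neighbour in V). Let M = {0,…,n−1} \ V. Then for every basis assignment b : M → {x,y,z}, every outcome string s : M → Fin 2, every choice of unit eigenvectors χ_j of σ_{b(j)} with eigenvalue (−1)^{s(j)}, every family of 2×2 Clifford unitaries U_0, …, U_{m−1}, and every scalar c ∈ ℂ with c ≠ 0, one has (⨂_i U_i) φ ≠ c · GHZ_m, where φ is the post-measurement state determined by M, b, s and the χ_j. -/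

import Mathlib

noncomputable section

/-- The `j`-th bit of a bit string `v : Fin k → Fin 2`, with out-of-range indices
giving `0`. -/
def bitAt (k : ℕ) (v : Fin k → Fin 2) (j : ℕ) : Fin 2 :=
  if h : j < k then v ⟨j, h⟩ else 0

/-- The `n`-qubit linear cluster state:
`L_n(v) = (√2)^{−n} · (−1)^{Σ_{i=0}^{n−2} v_i·v_{i+1}}`. -/
def linCluster (n : ℕ) : (Fin n → Fin 2) → ℂ := fun v =>
  ((Real.sqrt 2 : ℂ))⁻¹ ^ n *
    (-1 : ℂ) ^ (∑ i ∈ Finset.range (n - 1), (bitAt n v i : ℕ) * (bitAt n v (i + 1) : ℕ))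

/-- The `m`-qubit GHZ state: `GHZ_m(w) = (√2)^{−1}` if `w` is constant, `0` otherwise. -/
def ghzState (m : ℕ) : (Fin m → Fin 2) → ℂ := fun w =>
  if ∀ i j : Fin m, w i = w j then ((Real.sqrt 2 : ℂ))⁻¹ else 0

/-- The Pauli matrix `σ_x`. -/
def sigmaX : Matrix (Fin 2) (Fin 2) ℂ := !![0, 1; 1, 0]

/-- The Pauli matrix `σ_y`. -/
def sigmaY : Matrix (Fin 2) (Fin 2) ℂ := !![0, -Complex.I; Complex.I, 0]

/-- The Pauli matrix `σ_z`. -/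
def sigmaZ : Matrix (Fin 2) (Fin 2) ℂ := !![1, 0; 0, -1]

/-- The Hadamard matrix `(1/√2)·!![1,1;1,−1]`. -/
def hadamard : Matrix (Fin 2) (Fin 2) ℂ := ((Real.sqrt 2 : ℂ))⁻¹ • !![1, 1; 1, -1]

/-- A measurement basis label: `x`, `y` or `z`. -/
inductive PauliBasis | x | y | z

/-- The Pauli matrix corresponding to a basis label. -/
def pauliOf : PauliBasis → Matrix (Fin 2) (Fin 2) ℂ
  | .x => sigmaX
  | .y => sigmaY
  | .z => sigmaZ

/-- The (unnormalized) post-measurement state on the unmeasured qubits: for a target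
bit string `w : Fin m → Fin 2`,
`φ(w) = Σ_{v : Fin n → Fin 2, v ∘ ι = w} (∏_{j∈M} conj(χ_j(v(j)))) · L_n(v)`,
where `ι` is the enumeration of the unmeasured qubits and `χ_j` the post-measurement
single-qubit states on the measured qubits `j ∈ M`. -/
def postMeas (n m : ℕ) (M : Finset ℕ) (ι : Fin m → ℕ) (χ : ℕ → Fin 2 → ℂ) :
    (Fin m → Fin 2) → ℂ := fun w =>
  ∑ v ∈ Finset.univ.filter (fun v : Fin n → Fin 2 => ∀ i : Fin m, bitAt n v (ι i) = w i),
    (∏ j ∈ M, (starRingEnd ℂ) (χ j (bitAt n v j))) * linCluster n v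

/-- The action of a tensor product `⨂_i U_i` of single-qubit operators on an `m`-qubit
state vector: `((⨂_i U_i)ψ)(w) = Σ_{w'} (∏_i U_i(w(i), w'(i))) · ψ(w')`. -/
def localApply (m : ℕ) (U : Fin m → Matrix (Fin 2) (Fin 2) ℂ)
    (ψ : (Fin m → Fin 2) → ℂ) : (Fin m → Fin 2) → ℂ := fun w =>
  ∑ w' : Fin m → Fin 2, (∏ i : Fin m, U i (w i) (w' i)) * ψ w'

/-- A `2×2` matrix is a Clifford unitary if it is unitary and conjugates each of
`σ_x, σ_z` into `{±1, ±i} · {1, σ_x, σ_y, σ_z}`. -/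
def IsClifford (U : Matrix (Fin 2) (Fin 2) ℂ) : Prop :=
  U ∈ Matrix.unitaryGroup (Fin 2) ℂ ∧
  ∀ P ∈ ({sigmaX, sigmaZ} : Set (Matrix (Fin 2) (Fin 2) ℂ)),
    ∃ c ∈ ({1, -1, Complex.I, -Complex.I} : Set ℂ),
      ∃ Q ∈ ({1, sigmaX, sigmaY, sigmaZ} : Set (Matrix (Fin 2) (Fin 2) ℂ)),
        U * P * U⁻¹ = c • Q

/-- The sign `(-1)^{ab}` contributed by a single edge of the cluster. -/
def edgeSign (a b : Fin 2) : ℂ := (-1) ^ ((a : ℕ) * (b : ℕ))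

/-- The weighted sum over all bit strings on a path of `n` vertices attached to a vertex
carrying the bit `a`, where `f q` is the weight of vertex `q`. -/
def pathVec : ℕ → (ℕ → Fin 2 → ℂ) → Fin 2 → ℂ
  | 0, _, _ => 1
  | n + 1, f, a => ∑ b : Fin 2, edgeSign a b * f 0 b * pathVec n (fun q => f (q + 1)) b

/-- The transfer matrix of the first `p` vertices of a path with weights `f`. -/
def pathMat : ℕ → (ℕ → Fin 2 → ℂ) → Fin 2 → Fin 2 → ℂ
  | 0, _, a, b => if a = b then 1 else 0
  | p + 1, f, a, b =>
    ∑ d : Fin 2, edgeSign a d * f 0 d * pathMat p (fun q => f (q + 1)) d b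

lemma pathVec_congr (n : ℕ) {f g : ℕ → Fin 2 → ℂ} (h : ∀ q < n, f q = g q) :
    pathVec n f = pathVec n g := by
  induction n generalizing f g with
  | zero => rfl
  | succ n ih =>
    funext a
    simp only [pathVec]
    rw [ih (f := fun q => f (q + 1)) (g := fun q => g (q + 1))
      (fun q hq => h (q + 1) (by omega)), h 0 (by omega)]

lemma pathMat_congr (p : ℕ) {f g : ℕ → Fin 2 → ℂ} (h : ∀ q < p, f q = g q) :
    pathMat p f = pathMat p g := by
  induction p generalizing f g with
  | zero => rfl
  | succ p ih =>
    funext a b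
    simp only [pathMat]
    rw [ih (f := fun q => f (q + 1)) (g := fun q => g (q + 1))
      (fun q hq => h (q + 1) (by omega)), h 0 (by omega)]

lemma pathVec_add (p r : ℕ) (f : ℕ → Fin 2 → ℂ) (a : Fin 2) :
    pathVec (p + r) f a
      = ∑ b : Fin 2, pathMat p f a b * pathVec r (fun q => f (p + q)) b := by
  induction p generalizing f a with
  | zero => simp [pathMat]
  | succ p ih =>
    rw [Nat.add_right_comm]
    simp only [pathVec, pathMat, ih, Finset.mul_sum, Finset.sum_mul]
    rw [Finset.sum_comm]
    refine Finset.sum_congr rfl fun b _ => Finset.sum_congr rfl fun d _ => ?_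
    simp only [mul_assoc, Nat.add_right_comm]

lemma bitAt_cons_zero (n : ℕ) (b : Fin 2) (v : Fin n → Fin 2) :
    bitAt (n + 1) (Fin.cons b v : Fin (n + 1) → Fin 2) 0 = b := by
  simp [bitAt]

lemma bitAt_cons_succ (n : ℕ) (b : Fin 2) (v : Fin n → Fin 2) (q : ℕ) :
    bitAt (n + 1) (Fin.cons b v : Fin (n + 1) → Fin 2) (q + 1) = bitAt n v q := by
  unfold bitAt
  by_cases h : q < n
  · rw [dif_pos h, dif_pos (by omega : q + 1 < n + 1)]
    exact Fin.cons_succ (α := fun _ => Fin 2) b v ⟨q, h⟩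
  · rw [dif_neg h, dif_neg (by omega)]

lemma sum_path_eq_pathVec (n : ℕ) (f : ℕ → Fin 2 → ℂ) (a : Fin 2) :
    ∑ v : Fin n → Fin 2, (∏ q ∈ Finset.range n, f q (bitAt n v q)) *
      (-1 : ℂ) ^ ((a : ℕ) * (bitAt n v 0 : ℕ) +
        ∑ q ∈ Finset.range (n - 1), (bitAt n v q : ℕ) * (bitAt n v (q + 1) : ℕ))
      = pathVec n f a := by
  induction n generalizing f a with
  | zero => simp [pathVec, bitAt]
  | succ n ih =>
    rw [← (Fin.consEquiv fun _ : Fin (n + 1) => Fin 2).sum_comp, Fintype.sum_prod_type]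
    simp only [pathVec]
    refine Finset.sum_congr rfl fun b _ => ?_
    rw [← ih, Finset.mul_sum]
    refine Finset.sum_congr rfl fun v _ => ?_
    have hexp : ∑ q ∈ Finset.range n,
        (bitAt (n + 1) (Fin.cons b v : Fin (n + 1) → Fin 2) q : ℕ) * (bitAt n v q : ℕ)
        = (b : ℕ) * (bitAt n v 0 : ℕ) +
          ∑ q ∈ Finset.range (n - 1), (bitAt n v q : ℕ) * (bitAt n v (q + 1) : ℕ) := by
      cases n with
      | zero => simp [bitAt]
      | succ n =>
        rw [Finset.sum_range_succ', add_comm]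
        simp only [bitAt_cons_zero, bitAt_cons_succ, Nat.add_sub_cancel]
    simp only [Fin.consEquiv, Equiv.coe_fn_mk, Finset.prod_range_succ', bitAt_cons_zero,
      bitAt_cons_succ, Nat.add_sub_cancel, hexp, edgeSign]
    rw [pow_add]
    ring

/-- The weight of vertex `q` in an amplitude of the locally transformed post-measurement
state: a row of the local operator on an unmeasured vertex, where `u` lists the output bits,
and the conjugated measurement vector on a measured vertex. -/
def siteWeight {m : ℕ} (V : Finset ℕ) (hcard : V.card = m)
    (U : Fin m → Matrix (Fin 2) (Fin 2) ℂ) (χ : ℕ → Fin 2 → ℂ) (u : ℕ → Fin 2)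
    (q : ℕ) (a : Fin 2) : ℂ :=
  if h : q ∈ V then U ((V.orderIsoOfFin hcard).symm ⟨q, h⟩) (u q) a
  else (starRingEnd ℂ) (χ q a)

lemma siteWeight_congr {m : ℕ} (V : Finset ℕ) (hcard : V.card = m)
    (U : Fin m → Matrix (Fin 2) (Fin 2) ℂ) (χ : ℕ → Fin 2 → ℂ) {u u' : ℕ → Fin 2}
    {q : ℕ} (h : u q = u' q) :
    siteWeight V hcard U χ u q = siteWeight V hcard U χ u' q := by
  funext a
  simp only [siteWeight, h]

lemma localApply_postMeas (n m : ℕ) (M : Finset ℕ) (ι : Fin m → ℕ) (χ : ℕ → Fin 2 → ℂ)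
    (U : Fin m → Matrix (Fin 2) (Fin 2) ℂ) (w : Fin m → Fin 2) :
    localApply m U (postMeas n m M ι χ) w
      = ∑ v : Fin n → Fin 2, (∏ p : Fin m, U p (w p) (bitAt n v (ι p))) *
          ((∏ j ∈ M, (starRingEnd ℂ) (χ j (bitAt n v j))) * linCluster n v) := by
  simp only [localApply, postMeas, Finset.sum_filter, Finset.mul_sum]
  rw [Finset.sum_comm]
  refine Finset.sum_congr rfl fun v _ => ?_
  rw [Finset.sum_eq_single fun p => bitAt n v (ι p)]
  · simp
  · intro w' _ hw'
    rw [if_neg fun h => hw' (funext fun p => (h p).symm), mul_zero]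
  · simp

lemma prod_siteWeight {n m : ℕ} (V : Finset ℕ) (hVsub : V ⊆ Finset.range n)
    (hcard : V.card = m) (U : Fin m → Matrix (Fin 2) (Fin 2) ℂ) (χ : ℕ → Fin 2 → ℂ)
    (u t : ℕ → Fin 2) :
    ∏ q ∈ Finset.range n, siteWeight V hcard U χ u q (t q)
      = (∏ p : Fin m, U p (u (V.orderIsoOfFin hcard p)) (t (V.orderIsoOfFin hcard p))) *
        ∏ q ∈ Finset.range n \ V, (starRingEnd ℂ) (χ q (t q)) := by
  rw [← Finset.prod_sdiff hVsub, mul_comm]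
  congr 1
  · rw [← Finset.prod_coe_sort, ← (V.orderIsoOfFin hcard).toEquiv.prod_comp]
    refine Finset.prod_congr rfl fun p _ => ?_
    have hp : (V.orderIsoOfFin hcard).toEquiv p = V.orderIsoOfFin hcard p := rfl
    rw [hp, siteWeight, dif_pos (V.orderIsoOfFin hcard p).2, Subtype.coe_eta,
      OrderIso.symm_apply_apply]
  · refine Finset.prod_congr rfl fun q hq => ?_
    rw [siteWeight, dif_neg (Finset.mem_sdiff.mp hq).2]

lemma localApply_postMeas_eq_pathVec {n m : ℕ} (V : Finset ℕ) (hVsub : V ⊆ Finset.range n)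
    (hcard : V.card = m) (U : Fin m → Matrix (Fin 2) (Fin 2) ℂ) (χ : ℕ → Fin 2 → ℂ)
    (u : ℕ → Fin 2) :
    localApply m U (postMeas n m (Finset.range n \ V)
        (fun p => (V.orderIsoOfFin hcard p : ℕ)) χ) (fun p => u (V.orderIsoOfFin hcard p))
      = ((Real.sqrt 2 : ℂ))⁻¹ ^ n * pathVec n (siteWeight V hcard U χ u) 0 := by
  rw [localApply_postMeas, ← sum_path_eq_pathVec, Finset.mul_sum]
  refine Finset.sum_congr rfl fun v _ => ?_
  rw [prod_siteWeight V hVsub hcard U χ u (bitAt n v), linCluster]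
  simp only [Fin.val_zero, zero_mul, zero_add]
  ring

lemma pathVec_split (i r : ℕ) (f : ℕ → Fin 2 → ℂ) :
    pathVec (i + (r + 2)) f 0 = ∑ b : Fin 2, ∑ d : Fin 2,
      f i b * ((∑ a : Fin 2, pathMat i f 0 a * edgeSign a b) * edgeSign b d *
        pathVec r (fun q => f (i + (q + 2))) d) * f (i + 1) d := by
  rw [pathVec_add]
  simp only [pathVec, Fin.sum_univ_two, add_zero, zero_add, add_assoc, Nat.reduceAdd]
  ring

lemma eq_zero_of_unitary_bilinear {A B K : Matrix (Fin 2) (Fin 2) ℂ}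
    (hA : A ∈ Matrix.unitaryGroup (Fin 2) ℂ) (hB : B ∈ Matrix.unitaryGroup (Fin 2) ℂ)
    (h : ∀ x y, ∑ b : Fin 2, ∑ d : Fin 2, A x b * K b d * B y d = 0) : K = 0 := by
  have hK : A * K * B.transpose = 0 := by
    ext x y
    rw [Matrix.mul_apply]
    simp only [Matrix.mul_apply, Finset.sum_mul, Matrix.transpose_apply, Matrix.zero_apply]
    rw [Finset.sum_comm]
    exact h x y
  have hA' : IsUnit A := (Matrix.isUnit_iff_isUnit_det A).2
    (Matrix.UnitaryGroup.det_isUnit ⟨A, hA⟩)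
  have hB' : IsUnit B.transpose := (Matrix.isUnit_transpose _).2 <|
    (Matrix.isUnit_iff_isUnit_det B).2 (Matrix.UnitaryGroup.det_isUnit ⟨B, hB⟩)
  rw [hB'.mul_left_eq_zero, hA'.mul_right_eq_zero] at hK
  exact hK

/-- **Lemma 1 (quantum form).** If `V` contains a `2`-island `{i, i+1}` with both a
neighbour `j < i` and a neighbour `k > i+1` in `V`, then no Pauli measurement pattern on
the complementary qubits `M`, followed by local Clifford unitaries, can turn the
`n`-qubit linear cluster state into the `|V|`-qubit GHZ state. -/
theorem no_ghz_from_interior_two_island (n m : ℕ) (V : Finset ℕ)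
    (hVsub : V ⊆ Finset.range n) (hcard : V.card = m)
    (i j k : ℕ) (hiV : i ∈ V) (hi1V : i + 1 ∈ V) (hjV : j ∈ V) (hkV : k ∈ V)
    (hji : j < i) (hik : i + 1 < k)
    (M : Finset ℕ) (hM : M = Finset.range n \ V)
    (b : ℕ → PauliBasis)
    (s : ℕ → Fin 2)
    (χ : ℕ → Fin 2 → ℂ)
    (hχunit : ∀ j₀ ∈ M, ∑ a : Fin 2, ‖χ j₀ a‖ ^ 2 = 1)
    (hχeig : ∀ j₀ ∈ M, (pauliOf (b j₀)).mulVec (χ j₀) = ((-1 : ℂ) ^ (s j₀ : ℕ)) • χ j₀)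
    (U : Fin m → Matrix (Fin 2) (Fin 2) ℂ) (hU : ∀ i₀ : Fin m, IsClifford (U i₀))
    (c : ℂ) (hc : c ≠ 0) :
    localApply m U (postMeas n m M (fun i₀ => (V.orderIsoOfFin hcard i₀ : ℕ)) χ)
      ≠ c • ghzState m := by
  intro heq
  subst hM
  obtain ⟨r, rfl⟩ : ∃ r, n = i + (r + 2) :=
    ⟨n - (i + 2), by have := Finset.mem_range.mp (hVsub hi1V); omega⟩
  set Z : (ℕ → Fin 2) → ℂ := fun u => pathVec (i + (r + 2)) (siteWeight V hcard U χ u) 0 with hZ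
  have hamp (u : ℕ → Fin 2) : ((Real.sqrt 2 : ℂ))⁻¹ ^ (i + (r + 2)) * Z u
      = c * ghzState m (fun p => u (V.orderIsoOfFin hcard p)) := by
    rw [hZ, ← localApply_postMeas_eq_pathVec V hVsub hcard U χ u, heq]
    rfl
  have hsqrt : ((Real.sqrt 2 : ℂ))⁻¹ ≠ 0 := by simp
  have hconst (t : Fin 2) : Z (fun _ => t) ≠ 0 := by
    intro h0
    have h := hamp fun _ => t
    rw [h0, mul_zero] at h
    simp [ghzState, hc] at h
  have hmixed (u : ℕ → Fin 2) (hj0 : u j = 0) (hk1 : u k = 1) : Z u = 0 := by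
    have h := hamp u
    rw [ghzState, if_neg, mul_zero] at h
    · exact (mul_eq_zero.mp h).resolve_left (pow_ne_zero _ hsqrt)
    · intro hall
      have := hall ((V.orderIsoOfFin hcard).symm ⟨j, hjV⟩)
        ((V.orderIsoOfFin hcard).symm ⟨k, hkV⟩)
      simp [hj0, hk1] at this
  set X : (ℕ → Fin 2) → Fin 2 → ℂ := fun u b =>
    ∑ a : Fin 2, pathMat i (siteWeight V hcard U χ u) 0 a * edgeSign a b with hX
  set Y : (ℕ → Fin 2) → Fin 2 → ℂ := fun u d =>
    pathVec r (fun q => siteWeight V hcard U χ u (i + (q + 2))) d with hY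
  have hsplit (u : ℕ → Fin 2) : Z u = ∑ b : Fin 2, ∑ d : Fin 2,
      siteWeight V hcard U χ u i b * (X u b * edgeSign b d * Y u d) *
        siteWeight V hcard U χ u (i + 1) d := pathVec_split i r _
  obtain ⟨b₀, hb₀⟩ : ∃ b, X (fun _ => 0) b ≠ 0 := by
    by_contra! h
    exact hconst 0 (by rw [hsplit]; simp [h])
  obtain ⟨d₀, hd₀⟩ : ∃ d, Y (fun _ => 1) d ≠ 0 := by
    by_contra! h
    exact hconst 1 (by rw [hsplit]; simp [h])
  set K : Matrix (Fin 2) (Fin 2) ℂ :=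
    Matrix.of fun b d => X (fun _ => 0) b * edgeSign b d * Y (fun _ => 1) d with hK
  have hK0 : K = 0 := by
    refine eq_zero_of_unitary_bilinear (hU ((V.orderIsoOfFin hcard).symm ⟨i, hiV⟩)).1
      (hU ((V.orderIsoOfFin hcard).symm ⟨i + 1, hi1V⟩)).1 fun x y => ?_
    let u : ℕ → Fin 2 := fun q =>
      if q < i then 0 else if q = i then x else if q = i + 1 then y else 1
    have hXu : X u = X fun _ => 0 := by
      simp only [hX]
      rw [pathMat_congr i fun q hq => siteWeight_congr V hcard U χ (u' := fun _ => 0)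
        (show u q = 0 by simp [u, hq])]
    have hYu : Y u = Y fun _ => 1 := pathVec_congr r fun q _ =>
      siteWeight_congr V hcard U χ (show u (i + (q + 2)) = 1 by simp [u])
    have h := hmixed u (by simp [u, hji])
      (by simp [u, show ¬ k < i by omega, show k ≠ i by omega, show k ≠ i + 1 by omega])
    rw [hsplit, hXu, hYu] at h
    simpa [siteWeight, hiV, hi1V, u, K] using h
  have h := congrFun (congrFun hK0 b₀) d₀
  simp [hK, hb₀, hd₀, edgeSign] at h

end
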